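/- arXiv:1812.02195 — 7 statements merged into one kernel-verified Lean document; each statement's English description precedes it below -/
import Mathlib

section
/- Let k > N ≥ 1 and n ≥ i ≥ 0 be integers and let f be an element of the formal power series ring ℂ⟦t, z_0, …, z_n⟧ in n+2 variables over ℂ. Then there is a ℂ-algebra isomorphism between ℂ⟦t, z_0, …, z_n⟧/(z_0⋯z_i − t^N) and ℂ⟦t, z_0, …, z_n⟧/(z_0⋯z_i − t^N − t^k·f) which sends the class of t to the class of t. -/
namespace MvPowerSeries

variable {σ R : Type*} [CommRing R]

theorem X_dvd_subst_sub_subst {τ : Type*} {a b : σ → MvPowerSeries τ R} (ha : HasSubst a)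
    (hb : HasSubst b) {t : τ} (hab : ∀ s, X t ∣ a s - b s) (g : MvPowerSeries σ R) :
    X t ∣ subst a g - subst b g := by
  rw [X_dvd_iff]
  intro m hm
  rw [map_sub, sub_eq_zero, coeff_subst ha, coeff_subst hb]
  refine finsum_congr fun d ↦ ?_
  have h : X t ∣ (d.prod fun s e ↦ a s ^ e) - d.prod fun s e ↦ b s ^ e := by
    rw [← Ideal.mem_span_singleton, ← Ideal.Quotient.eq, map_finsuppProd, map_finsuppProd]
    simp only [map_pow]
    refine Finsupp.prod_congr fun s _ ↦ ?_
    rw [Ideal.Quotient.eq.mpr (Ideal.mem_span_singleton.mpr (hab s))]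
  rw [sub_eq_zero.mp ((map_sub _ _ _).symm.trans (X_dvd_iff.mp h m hm))]

theorem eq_zero_of_forall_X_pow_dvd {t : σ} {g : MvPowerSeries σ R}
    (h : ∀ n : ℕ, X t ^ n ∣ g) : g = 0 := by
  ext m
  exact X_pow_dvd_iff.mp (h (m t + 1)) m (Nat.lt_succ_self _)

theorem exists_forall_X_pow_dvd_sub_sum (t : σ) (h : ℕ → MvPowerSeries σ R) :
    ∃ g : MvPowerSeries σ R, ∀ n : ℕ, X t ^ n ∣ g - ∑ j ∈ Finset.range n, X t ^ j * h j := by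
  obtain ⟨g, hg⟩ : ∃ g : MvPowerSeries σ R, ∀ m, coeff m g =
      coeff m (∑ j ∈ Finset.range (m t + 1), X t ^ j * h j) := ⟨fun m ↦ _, fun _ ↦ rfl⟩
  refine ⟨g, fun n ↦ ?_⟩
  rw [X_pow_dvd_iff]
  intro m hm
  rw [map_sub, sub_eq_zero, hg, map_sum, map_sum]
  refine Finset.sum_subset (Finset.range_mono hm) fun j _ hj ↦ ?_
  exact X_pow_dvd_iff.mp (Dvd.intro _ rfl) m (by simpa using hj)

theorem bijective_of_X_dvd_sub {t : σ} (φ : MvPowerSeries σ R →+* MvPowerSeries σ R)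
    (ht : φ (X t) = X t) (hφ : ∀ g, X t ∣ φ g - g) : Function.Bijective φ := by
  constructor
  · rw [injective_iff_map_eq_zero]
    intro g hg
    refine eq_zero_of_forall_X_pow_dvd (t := t) fun n ↦ ?_
    suffices ∃ q, g = X t ^ n * q ∧ φ q = 0 from
      let ⟨q, hq, _⟩ := this; ⟨q, hq⟩
    induction n with
    | zero => exact ⟨g, by simp, hg⟩
    | succ n ih =>
      obtain ⟨q, rfl, hq⟩ := ih
      obtain ⟨r, hr⟩ := hφ q
      have hqr : q = X t * -r := by linear_combination hq - hr
      refine ⟨-r, by rw [pow_succ, mul_assoc, ← hqr], ?_⟩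
      rw [hqr, map_mul, ht] at hq
      exact (mul_right_mem_nonZeroDivisors_eq_zero_iff X_mem_nonzeroDivisors).mp
        ((mul_comm _ _).trans hq)
  · intro h
    choose D hD using hφ
    obtain ⟨g, hg⟩ := exists_forall_X_pow_dvd_sub_sum t fun n ↦ (fun q ↦ -D q)^[n] h
    refine ⟨g, sub_eq_zero.mp (eq_zero_of_forall_X_pow_dvd (t := t) fun n ↦ ?_)⟩
    have hsum : φ (∑ j ∈ Finset.range n, X t ^ j * (fun q ↦ -D q)^[j] h) =
        h - X t ^ n * (fun q ↦ -D q)^[n] h := by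
      induction n with
      | zero => simp
      | succ n ih =>
        rw [Finset.sum_range_succ, map_add, ih, map_mul, map_pow, ht,
          Function.iterate_succ_apply']
        linear_combination X t ^ n * hD ((fun q ↦ -D q)^[n] h)
    have hdvd := map_dvd φ (hg n)
    rw [map_pow, ht, map_sub, hsum] at hdvd
    have := dvd_sub hdvd (Dvd.intro ((fun q ↦ -D q)^[n] h) rfl)
    convert this using 1
    ring

/-- The substitution `X s ↦ X s * u` is an automorphism when `u` is congruent to `1` modulo
another variable. -/
theorem exists_algEquiv_X_mul [Finite σ] [DecidableEq σ] {s t : σ} (hst : t ≠ s)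
    {u : MvPowerSeries σ R} (hu : X t ∣ u - 1) :
    ∃ e : MvPowerSeries σ R ≃ₐ[R] MvPowerSeries σ R,
      e (X s) = X s * u ∧ ∀ r ≠ s, e (X r) = X r := by
  set a : σ → MvPowerSeries σ R := Function.update X s (X s * u) with ha_def
  have has : a s = X s * u := Function.update_self ..
  have har : ∀ r ≠ s, a r = X r := fun r hr ↦ Function.update_of_ne hr ..
  have ha : HasSubst a := hasSubst_of_constantCoeff_zero fun r ↦ by
    by_cases hr : r = s
    · simp [hr, has]
    · simp [har r hr]
  have hbij : Function.Bijective (substAlgHom (R := R) ha) := by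
    refine bijective_of_X_dvd_sub (t := t) (substAlgHom (R := R) ha).toRingHom
      ((substAlgHom_X ha t).trans (har t hst)) fun g ↦ ?_
    have h := X_dvd_subst_sub_subst (t := t) ha HasSubst.X (fun r ↦ ?_) g
    · rw [subst_self, id] at h
      simpa [coe_substAlgHom] using h
    · by_cases hr : r = s
      · rw [hr, has]
        simpa [mul_sub] using hu.mul_left (X s)
      · simp [har r hr]
  refine ⟨AlgEquiv.ofBijective _ hbij, ?_, fun r hr ↦ ?_⟩
  · exact (substAlgHom_X ha s).trans has
  · exact (substAlgHom_X ha r).trans (har r hr)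

end MvPowerSeries

/-- For integers `k > N ≥ 1` and `n ≥ i ≥ 0` and a formal power series
`f ∈ ℂ⟦t, z_0, …, z_n⟧`, the quotients of `ℂ⟦t, z_0, …, z_n⟧` by the principal ideals
`(z_0⋯z_i − t^N)` and `(z_0⋯z_i − t^N − t^k·f)` are isomorphic as `ℂ`-algebras, by an
isomorphism sending the class of `t` to the class of `t`.
Here the variables are indexed by `Fin (n+2)`, with `t` the variable of index `0` and
`z_j` the variable of index `j+1`. -/
theorem normal_crossing_finite_determinacy
    (N k n i : ℕ) (hN : 1 ≤ N) (hk : N < k) (hi : i ≤ n)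
    (f : MvPowerSeries (Fin (n + 2)) ℂ) :
    ∃ e : (MvPowerSeries (Fin (n + 2)) ℂ ⧸
        Ideal.span {(∏ j : Fin (i + 1),
            MvPowerSeries.X (⟨j.val + 1, by have := j.isLt; omega⟩ : Fin (n + 2))) -
          MvPowerSeries.X (0 : Fin (n + 2)) ^ N}) ≃ₐ[ℂ]
      (MvPowerSeries (Fin (n + 2)) ℂ ⧸
        Ideal.span {(∏ j : Fin (i + 1),
            MvPowerSeries.X (⟨j.val + 1, by have := j.isLt; omega⟩ : Fin (n + 2))) -
          MvPowerSeries.X (0 : Fin (n + 2)) ^ N -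
          MvPowerSeries.X (0 : Fin (n + 2)) ^ k * f}),
      e (Ideal.Quotient.mk _ (MvPowerSeries.X (0 : Fin (n + 2)))) =
        Ideal.Quotient.mk _ (MvPowerSeries.X (0 : Fin (n + 2))) := by
  have hm : k - N ≠ 0 := by omega
  have hkN : k = N + (k - N) := by omega
  set t : MvPowerSeries (Fin (n + 2)) ℂ := MvPowerSeries.X 0
  have hv : IsUnit (1 + t ^ (k - N) * f) := by
    rw [MvPowerSeries.isUnit_iff_constantCoeff]
    simp [t, hm]
  obtain ⟨u, hu⟩ := hv.exists_left_inv
  have hu1 : t ∣ u - 1 :=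
    (dvd_pow_self t hm).trans ⟨-(f * u), by linear_combination hu⟩
  obtain ⟨e, he0, he⟩ := MvPowerSeries.exists_algEquiv_X_mul
    (s := (⟨1, by omega⟩ : Fin (n + 2))) (by simp) hu1
  have het : e t = t := he 0 (by simp)
  refine ⟨Ideal.quotientEquivAlg _ _ e ?_, ?_⟩
  · rw [Ideal.map_span, Set.image_singleton,
      ← Ideal.span_singleton_mul_right_unit (IsUnit.of_mul_eq_one _ hu)]
    congr 2
    have hprod : ∀ j : Fin i, e (MvPowerSeries.X (⟨j.succ.val + 1, by omega⟩ : Fin (n + 2))) =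
        MvPowerSeries.X (⟨j.succ.val + 1, by omega⟩ : Fin (n + 2)) :=
      fun j ↦ he _ (by simp [Fin.ext_iff])
    simp only [RingHom.coe_coe, map_sub, map_pow, map_mul, map_prod, Fin.prod_univ_succ,
      Fin.val_zero, zero_add, hprod]
    rw [het, he0, show t ^ k = t ^ N * t ^ (k - N) by rw [← pow_add, ← hkN]]
    linear_combination -t ^ N * hu
  · exact congrArg _ het
end

section
/- Let B be a commutative ring, t ∈ B, P = B[z_1,…,z_n] the polynomial ring in n variables over B, A a commutative B-algebra, and π : P → A a B-algebra homomorphism such that for some k ≥ 1 every element of A can be written as π(F) + t^k·b with F ∈ P and b ∈ A. For l ≥ 1 let J_l denote the kernel of the induced map P/(t^l) → A/t^lA. Then for every l ≥ 1 the natural map J_l → J_{l−1} induced by reduction modulo t^{l−1} is surjective. -/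
/-- Let `B` be a commutative ring, `t ∈ B`, `P = B[z_1,…,z_n]`, `A` a
commutative `B`-algebra and `π : P → A` a `B`-algebra map such that for some `k ≥ 1`
every element of `A` is of the form `π(F) + t^k·b`.  For `l ≥ 1` let
`J_l = ker(P/(t^l) → A/t^lA)`.  Then the natural map `J_l → J_{l−1}` is surjective:
any `a ∈ P` with `π(a) ≡ 0 mod t^{l−1}A` is congruent modulo `(t^{l−1})` to some
`a' ∈ P` with `π(a') ≡ 0 mod t^lA`. -/
theorem kernel_tower_surjective
    {B : Type*} [CommRing B] (t : B) (n : ℕ)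
    {A : Type*} [CommRing A] [Algebra B A]
    (π : MvPolynomial (Fin n) B →ₐ[B] A) (k : ℕ) (hk : 1 ≤ k)
    (h : ∀ a : A, ∃ F : MvPolynomial (Fin n) B, ∃ b : A,
      a = π F + algebraMap B A t ^ k * b) :
    ∀ l : ℕ, 1 ≤ l → ∀ a : MvPolynomial (Fin n) B,
      Ideal.Quotient.mk (Ideal.span {algebraMap B A t ^ (l - 1)}) (π a) = 0 →
      ∃ a' : MvPolynomial (Fin n) B,
        Ideal.Quotient.mk (Ideal.span {algebraMap B A t ^ l}) (π a') = 0 ∧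
        a' - a ∈ Ideal.span {(MvPolynomial.C t : MvPolynomial (Fin n) B) ^ (l - 1)} := by
  intro l hl a ha
  rw [Ideal.Quotient.eq_zero_iff_mem, Ideal.mem_span_singleton] at ha
  obtain ⟨c, hc⟩ := ha
  obtain ⟨F, b, hF⟩ := h c
  have hπt : π (MvPolynomial.C t) = algebraMap B A t := π.commutes t
  refine ⟨a - MvPolynomial.C t ^ (l - 1) * F, ?_, ?_⟩
  · have key : π (a - MvPolynomial.C t ^ (l - 1) * F) =
        algebraMap B A t ^ (l - 1 + k) * b := by
      rw [map_sub, map_mul, map_pow, hπt, hc, hF]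
      ring
    rw [Ideal.Quotient.eq_zero_iff_mem, Ideal.mem_span_singleton, key]
    exact (pow_dvd_pow _ (by lia)).mul_right b
  · rw [Ideal.mem_span_singleton]
    exact ⟨-F, by ring⟩
end

section
/- Let B be a Noetherian commutative ring, t ∈ B, P = B[z_1,…,z_n] the polynomial ring over B, A a Noetherian commutative B-algebra, and π : P → A a B-algebra homomorphism such that for some k ≥ 1 every element of A can be written as π(F) + t^k·b with F ∈ P and b ∈ A. Regard A as a P-module via π and let I be the ideal of P generated by t. Then the induced map of I-adic completions AdicCompletion I P → AdicCompletion I A (the map of inverse limits induced by the surjections-to-be P/t^lP → A/t^lA) is surjective. -/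
/-- Lemma 'lemma-Acirc': Let `B` be a Noetherian commutative ring, `t ∈ B`,
`P = B[z_1,…,z_n]`, `A` a Noetherian commutative `B`-algebra and `π : P → A` a
`B`-algebra map such that for some `k ≥ 1` every element of `A` can be written as
`π(F) + t^k·b`.  Regarding `A` as a `P`-module via `π` and letting `I = (t) ⊆ P`, the
induced map of `I`-adic completions `AdicCompletion I P → AdicCompletion I A` is
surjective. -/
theorem adicCompletion_map_surjective
    {B : Type*} [CommRing B] [IsNoetherianRing B] (t : B) (n : ℕ)
    {A : Type*} [CommRing A] [IsNoetherianRing A] [Algebra B A]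
    (π : MvPolynomial (Fin n) B →ₐ[B] A) (k : ℕ) (hk : 1 ≤ k)
    (h : ∀ a : A, ∃ F : MvPolynomial (Fin n) B, ∃ b : A,
      a = π F + algebraMap B A t ^ k * b) :
    letI : Algebra (MvPolynomial (Fin n) B) A := π.toRingHom.toAlgebra
    Function.Surjective
      (AdicCompletion.map
        (Ideal.span {(MvPolynomial.C t : MvPolynomial (Fin n) B)})
        (Algebra.linearMap (MvPolynomial (Fin n) B) A)) := by
  let _ : Algebra (MvPolynomial (Fin n) B) A := π.toRingHom.toAlgebra
  refine AdicCompletion.map_surjective_of_mkQ_comp_surjective fun y ↦ ?_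
  obtain ⟨a, rfl⟩ := Submodule.mkQ_surjective _ y
  obtain ⟨F, b, rfl⟩ := h a
  refine ⟨F, (Submodule.Quotient.eq _).mpr ?_⟩
  have hF : Algebra.linearMap (MvPolynomial (Fin n) B) A F = π F := rfl
  have ht : algebraMap B A t ^ k * b =
      (MvPolynomial.C t ^ k : MvPolynomial (Fin n) B) • b := by
    rw [Algebra.smul_def, map_pow]
    exact congrArg (· ^ k * b) (π.commutes t).symm
  rw [hF, sub_add_cancel_left, ht]
  exact neg_mem (Submodule.smul_mem_smul
    (Ideal.pow_mem_of_mem _ (Ideal.mem_span_singleton_self _) k hk) Submodule.mem_top)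
end

section
/- Let B be a Noetherian commutative ring, t ∈ B, and A a commutative B-algebra of finite type that is flat as a B-module. Let I be the ideal of B generated by t. Then the I-adic completion AdicCompletion I A of A (as a B-module) is flat as a module over the I-adic completion AdicCompletion I B of B. -/
section PrincipalAdic

variable {R M N : Type*} [CommRing R] [AddCommGroup M] [Module R M] [AddCommGroup N] [Module R N]

lemma mem_span_singleton_pow_smul_top {τ : R} {n : ℕ} {x : M} :
    x ∈ (Ideal.span {τ} ^ n • ⊤ : Submodule R M) ↔ ∃ y, τ ^ n • y = x := by
  rw [Ideal.span_singleton_pow, Submodule.ideal_span_singleton_smul,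
    Submodule.mem_smul_pointwise_iff_exists]
  simp

lemma eq_zero_of_forall_exists_pow_smul (τ : R) [IsHausdorff (Ideal.span {τ}) M] {x : M}
    (hx : ∀ n, ∃ y, τ ^ n • y = x) : x = 0 :=
  IsHausdorff.haus ‹_› x fun n ↦ SModEq.zero.2 (mem_span_singleton_pow_smul_top.2 (hx n))

/-- Successive approximation: if `M` is `τ`-adically precomplete and `N` is `τ`-adically separated,
a filtration `X` of a subset of `N` whose steps can be corrected by `τ`-divisible elements of the
range of `φ` is contained in this range. -/
lemma mem_range_of_successive_approximation {ι : Type*} [Finite ι] (τ : R)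
    [IsPrecomplete (Ideal.span {τ}) M]
    (hN : ∀ x : N, (∀ n, ∃ y, τ ^ n • y = x) → x = 0)
    (φ : (ι → M) →ₗ[R] N) (X : ℕ → Set N) (c : ℕ)
    (hX : ∀ n, ∀ x ∈ X n, ∃ y, τ ^ n • y = x)
    (step : ∀ n, ∀ x ∈ X n, ∃ y, x - τ ^ (n - c) • φ y ∈ X (n + 1))
    {x : N} (hx : x ∈ X 0) : x ∈ LinearMap.range φ := by
  choose! y hy using step
  let u : ℕ → N := fun n ↦ Nat.rec x (fun n v ↦ v - τ ^ (n - c) • φ (y n v)) n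
  have hu (n : ℕ) : u n ∈ X n := by
    induction n with
    | zero => exact hx
    | succ n ih => exact hy n _ ih
  have hus (n : ℕ) : u (n + 1) = u n - τ ^ (n - c) • φ (y n (u n)) := rfl
  let s : ℕ → ι → M := fun n ↦ ∑ i ∈ Finset.range n, τ ^ (i - c) • y i (u i)
  have hs (n : ℕ) : φ (s n) = x - u n := by
    induction n with
    | zero => simp [s, u]
    | succ n ih =>
      rw [hus, show s (n + 1) = s n + τ ^ (n - c) • y n (u n) from Finset.sum_range_succ _ _,
        map_add, ih, map_smul]
      abel
  have hcauchy (j : ι) {m n : ℕ} (hmn : m ≤ n) : s (m + c) j ≡ s (n + c) j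
      [SMOD (Ideal.span {τ} ^ m • ⊤ : Submodule R M)] := by
    induction n, hmn using Nat.le_induction with
    | base => rfl
    | succ n hn ih =>
      refine ih.trans (SModEq.symm (SModEq.sub_mem.2 (mem_span_singleton_pow_smul_top.2
        ⟨τ ^ (n - m) • y (n + c) (u (n + c)) j, ?_⟩)))
      rw [show s (n + 1 + c) = s (n + c) + τ ^ (n + c - c) • y (n + c) (u (n + c)) by
        rw [add_right_comm]; exact Finset.sum_range_succ _ _]
      rw [smul_smul, ← pow_add, Nat.add_sub_cancel' hn, Nat.add_sub_cancel]
      simp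
  choose L hL using fun j ↦ IsPrecomplete.prec ‹_› (fun {m n} h ↦ hcauchy j (m := m) (n := n) h)
  refine ⟨L, (sub_eq_zero.1 (hN (x - φ L) fun n ↦ ?_)).symm⟩
  choose w hw using fun j ↦ mem_span_singleton_pow_smul_top.1 (SModEq.sub_mem.1 (hL j n))
  obtain ⟨v, hv⟩ := hX (n + c) _ (hu (n + c))
  refine ⟨φ w + τ ^ c • v, ?_⟩
  have hw' : τ ^ n • w = s (n + c) - L := funext hw
  rw [smul_add, ← map_smul, hw', map_sub, hs, smul_smul, ← pow_add, hv]
  abel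

/-- A ring which is complete with respect to a principal ideal is noetherian if its quotient by this
ideal is. -/
lemma isNoetherianRing_of_isAdicComplete_span_singleton (τ : R)
    [IsAdicComplete (Ideal.span {τ}) R] [IsNoetherianRing (R ⧸ Ideal.span {τ})] :
    IsNoetherianRing R := by
  refine .of_prime fun P hP ↦ ?_
  obtain ⟨Q, hQ, hQP, hmap⟩ : ∃ Q : Ideal R, Q.FG ∧ Q ≤ P ∧ P ≤ Q ⊔ Ideal.span {τ} := by
    classical
    have hfg : (P.map (Ideal.Quotient.mk (Ideal.span {τ}))).FG := IsNoetherian.noetherian _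
    obtain ⟨_, hs, h⟩ := (Submodule.fg_span_iff_fg_span_finset_subset _).1 hfg
    obtain ⟨s, hsP, rfl⟩ := Finset.subset_set_image_iff.1 hs
    refine ⟨Ideal.span s, ⟨s, rfl⟩, Ideal.span_le.2 hsP, ?_⟩
    have hPs : P.map (Ideal.Quotient.mk (Ideal.span {τ})) =
        (Ideal.span s).map (Ideal.Quotient.mk (Ideal.span {τ})) := by
      rw [Ideal.map_span, ← Finset.coe_image]
      exact h
    have := Ideal.map_le_iff_le_comap.1 hPs.le
    rwa [Ideal.comap_map_of_surjective' _ Ideal.Quotient.mk_surjective, Ideal.mk_ker] at this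
  by_cases hτ : τ ∈ P
  · have : P = Q ⊔ Ideal.span {τ} :=
      le_antisymm hmap (sup_le hQP ((Ideal.span_singleton_le_iff_mem _).2 hτ))
    rw [this]
    exact Submodule.FG.sup hQ ⟨{τ}, by simp⟩
  · suffices P ≤ Q from le_antisymm hQP this ▸ hQ
    obtain ⟨m, q, rfl⟩ := Submodule.fg_iff_exists_fin_generating_family.1 hQ
    intro p hp
    rw [← Fintype.range_linearCombination]
    refine mem_range_of_successive_approximation τ
      (fun x hx ↦ eq_zero_of_forall_exists_pow_smul τ hx) (Fintype.linearCombination R q)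
      (fun n ↦ {x | ∃ p ∈ P, τ ^ n • p = x}) 0 (fun n x ⟨p, _, hp⟩ ↦ ⟨p, hp⟩) ?_ ⟨p, hp, by simp⟩
    rintro n _ ⟨p, hp, rfl⟩
    obtain ⟨a, ha, b, hb, rfl⟩ := Submodule.mem_sup.1 (hmap hp)
    obtain ⟨r, rfl⟩ := Ideal.mem_span_singleton'.1 hb
    have hr : r ∈ P := (hP.mem_or_mem ((P.add_mem_iff_right (hQP ha)).1 hp)).resolve_right hτ
    rw [← Fintype.range_linearCombination] at ha
    obtain ⟨y, rfl⟩ := ha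
    refine ⟨y, r, hr, ?_⟩
    simp only [smul_eq_mul, Nat.sub_zero]
    ring

/-- A consequence of the Artin-Rees lemma for a principal ideal. -/
lemma Submodule.exists_forall_pow_smul_mem [IsNoetherianRing R] [Module.Finite R M] (τ : R)
    (K : Submodule R M) :
    ∃ c : ℕ, ∀ n, ∀ a : M, τ ^ n • a ∈ K → ∃ k ∈ K, τ ^ n • a = τ ^ (n - c) • k := by
  obtain ⟨c, hc⟩ := Ideal.exists_pow_inf_eq_pow_smul (Ideal.span {τ}) K
  refine ⟨c, fun n a ha ↦ ?_⟩
  obtain hn | hn := le_total c n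
  · have : τ ^ n • a ∈ (Ideal.span {τ} ^ n • ⊤ : Submodule R M) ⊓ K :=
      ⟨mem_span_singleton_pow_smul_top.2 ⟨a, rfl⟩, ha⟩
    rw [hc n hn, Ideal.span_singleton_pow, Submodule.ideal_span_singleton_smul,
      Submodule.mem_smul_pointwise_iff_exists] at this
    obtain ⟨k, hk, h⟩ := this
    exact ⟨k, hk.2, h.symm⟩
  · exact ⟨_, ha, by simp [Nat.sub_eq_zero_of_le hn]⟩

/-- Let `M` be a `τ`-adically complete module over a noetherian ring such that, for every `n`, every
linear relation in `M / τ ^ n M` is trivial over `R / τ ^ n R`. Then `M` is flat. -/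
lemma Module.Flat.of_isAdicComplete_span_singleton [IsNoetherianRing R] (τ : R)
    [IsAdicComplete (Ideal.span {τ}) M]
    (H : ∀ (n l : ℕ) (g : Fin l → R) (z : Fin l → M) (v : M), ∑ i, g i • z i = τ ^ n • v →
      ∃ (k : ℕ) (a : Fin l → Fin k → R) (y : Fin k → M) (e : Fin l → M) (b : Fin k → R),
        (∀ i, z i = ∑ j, a i j • y j + τ ^ n • e i) ∧ ∀ j, ∑ i, g i * a i j = τ ^ n * b j) :
    Module.Flat R M := by
  refine .of_forall_isTrivialRelation fun {l f x} hx ↦ ?_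
  let F : (Fin l → R) →ₗ[R] R := Fintype.linearCombination R f
  have hF (a : Fin l → R) : F a = ∑ i, f i * a i := by
    simp [F, Fintype.linearCombination_apply, mul_comm]
  obtain ⟨c, hc⟩ := (LinearMap.ker F).exists_forall_pow_smul_mem τ
  obtain ⟨d, hd⟩ := (LinearMap.range F).exists_forall_pow_smul_mem τ
  obtain ⟨m, k, hk⟩ := Submodule.fg_iff_exists_fin_generating_family.1
    (IsNoetherian.noetherian (LinearMap.ker F))
  have hkF (s : Fin m) : ∑ i, f i * k s i = 0 := by
    rw [← hF]
    exact hk.le (Submodule.subset_span ⟨s, rfl⟩)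
  let φ : (Fin m → M) →ₗ[R] (Fin l → M) :=
    LinearMap.pi fun i ↦ ∑ s, k s i • LinearMap.proj s
  have hφ (y : Fin m → M) (i : Fin l) : φ y i = ∑ s, k s i • y s := by simp [φ]
  have hfφ (y : Fin m → M) : ∑ i, f i • φ y i = 0 := by
    simp_rw [hφ, Finset.smul_sum, smul_smul]
    rw [Finset.sum_comm]
    simp_rw [← Finset.sum_smul, hkF, zero_smul, Finset.sum_const_zero]
  obtain ⟨y, rfl⟩ : x ∈ LinearMap.range φ := by
    refine mem_range_of_successive_approximation τ
      (fun x hx ↦ funext fun i ↦ eq_zero_of_forall_exists_pow_smul τ fun n ↦ ?_) φ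
      (fun n ↦ {x | ∑ i, f i • x i = 0 ∧ ∃ y, τ ^ n • y = x}) c (fun n x hx ↦ hx.2) ?_
      ⟨hx, x, by simp⟩
    · obtain ⟨y, hy⟩ := hx n
      exact ⟨y i, congrFun hy i⟩
    rintro n _ ⟨hx, z, rfl⟩
    obtain ⟨p, a, y, e, b, hz, hb⟩ := H (n + 1 + d) l (fun i ↦ τ ^ n * f i) z 0 (by
      simpa [smul_smul, mul_comm] using hx)
    have hab (j : Fin p) : F (τ ^ n • fun i ↦ a i j) = τ ^ (n + 1 + d) • b j := by
      rw [smul_eq_mul, ← hb, hF]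
      exact Finset.sum_congr rfl fun i _ ↦ by simp; ring
    have hcorr (j : Fin p) : ∃ c', F (τ ^ n • fun i ↦ a i j) = F (τ ^ (n + 1) • c') := by
      obtain ⟨_, ⟨c', rfl⟩, h⟩ := hd (n + 1 + d) (b j) ⟨_, hab j⟩
      exact ⟨c', by rw [hab, h, Nat.add_sub_cancel, map_smul]⟩
    choose c' hc' using hcorr
    have hK (j : Fin p) : ∃ u : Fin m → R, τ ^ n • ((fun i ↦ a i j) - τ • c' j) =
        τ ^ (n - c) • ∑ s, u s • k s := by
      obtain ⟨k', hk', h⟩ := hc n ((fun i ↦ a i j) - τ • c' j) (by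
        rw [LinearMap.mem_ker, smul_sub, smul_smul, ← pow_succ, map_sub, hc', sub_self])
      rw [← hk, ← Fintype.range_linearCombination R] at hk'
      obtain ⟨u, rfl⟩ := hk'
      exact ⟨u, h⟩
    choose u hu using hK
    have hx' : τ ^ n • z - τ ^ (n - c) • φ (fun s ↦ ∑ j, u j s • y j) =
        τ ^ (n + 1) • ((fun i ↦ ∑ j, c' j i • y j) + τ ^ (n + d) • e) := by
      have hu' (i : Fin l) (j : Fin p) : τ ^ n * a i j =
          τ ^ (n + 1) * c' j i + τ ^ (n - c) * ∑ s, u j s * k s i := by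
        have := congrFun (hu j) i
        simp only [Pi.smul_apply, Pi.sub_apply, smul_eq_mul, Finset.sum_apply] at this
        rw [← this]
        ring
      have hφu (i : Fin l) : φ (fun s ↦ ∑ j, u j s • y j) i =
          ∑ j, (∑ s, u j s * k s i) • y j := by
        simp_rw [hφ, Finset.smul_sum, Finset.sum_smul, smul_smul]
        rw [Finset.sum_comm]
        simp_rw [mul_comm]
      funext i
      simp only [Pi.sub_apply, Pi.smul_apply, Pi.add_apply, hφu, hz, smul_add, Finset.smul_sum,
        smul_smul, hu', add_smul, Finset.sum_add_distrib, ← pow_add]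
      rw [show n + (n + 1 + d) = n + 1 + (n + d) by ring]
      abel
    refine ⟨fun s ↦ ∑ j, u j s • y j, ?_, _, hx'.symm⟩
    simp only [Pi.sub_apply, smul_sub, Finset.sum_sub_distrib, hx, zero_sub, neg_eq_zero]
    simp only [Pi.smul_apply, smul_comm (f _) (τ ^ (n - c)), ← Finset.smul_sum, hfφ, smul_zero]
  exact ⟨m, fun i s ↦ k s i, y, hφ y, hkF⟩

end PrincipalAdic

namespace AdicCompletion

variable {B : Type*} [CommRing B] (t : B) {M : Type*} [AddCommGroup M] [Module B M]

lemma isAdicComplete_span_singleton_algebraMap :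
    IsAdicComplete (Ideal.span {algebraMap B (AdicCompletion (Ideal.span {t}) B) t})
      (AdicCompletion (Ideal.span {t}) M) := by
  have := isAdicComplete (M := M) (I := Ideal.span {t}) ⟨{t}, by simp⟩
  rw [← IsAdicComplete.map_algebraMap_iff (S := AdicCompletion (Ideal.span {t}) B), Ideal.map_span,
    Set.image_singleton] at this
  exact this

lemma exists_eq_of_add_pow_smul (n : ℕ) (x : AdicCompletion (Ideal.span {t}) M) :
    ∃ m y, x = of (Ideal.span {t}) M m + t ^ n • y := by
  obtain ⟨m, hm⟩ := Submodule.mkQ_surjective _ (eval (Ideal.span {t}) M n x)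
  have : x - of (Ideal.span {t}) M m ∈ (eval (Ideal.span {t}) M n).ker := by
    rw [LinearMap.mem_ker, map_sub, eval_of, hm, sub_self]
  rw [← pow_smul_top_eq_ker_eval ⟨{t}, by simp⟩, mem_span_singleton_pow_smul_top] at this
  obtain ⟨y, hy⟩ := this
  exact ⟨m, y, by rw [hy]; abel⟩

variable {t} in
lemma exists_pow_smul_eq_of_of_eq {n : ℕ} {m : M} {y : AdicCompletion (Ideal.span {t}) M}
    (h : of (Ideal.span {t}) M m = t ^ n • y) : ∃ v, t ^ n • v = m := by
  rw [← mem_span_singleton_pow_smul_top, ← Submodule.Quotient.mk_eq_zero, ← Submodule.mkQ_apply,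
    ← eval_of, h, ← LinearMap.mem_ker, ← pow_smul_top_eq_ker_eval ⟨{t}, by simp⟩,
    mem_span_singleton_pow_smul_top]
  exact ⟨y, rfl⟩

lemma isNoetherianRing_span_singleton [IsNoetherianRing B] :
    IsNoetherianRing (AdicCompletion (Ideal.span {t}) B) := by
  let τ := algebraMap B (AdicCompletion (Ideal.span {t}) B) t
  have : IsAdicComplete (Ideal.span {τ}) (AdicCompletion (Ideal.span {t}) B) :=
    isAdicComplete_span_singleton_algebraMap t
  have : IsNoetherianRing (AdicCompletion (Ideal.span {t}) B ⧸ Ideal.span {τ}) := by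
    refine isNoetherianRing_of_surjective B _ ((Ideal.Quotient.mk (Ideal.span {τ})).comp
      (algebraMap B _)) fun x ↦ ?_
    obtain ⟨x, rfl⟩ := Ideal.Quotient.mk_surjective x
    obtain ⟨b, y, rfl⟩ := exists_eq_of_add_pow_smul t 1 x
    refine ⟨b, Ideal.Quotient.eq.2 (Ideal.mem_span_singleton'.2 ⟨-y, ?_⟩)⟩
    rw [pow_one, Algebra.smul_def, mul_comm]
    change τ * -y = of _ B b - (of _ B b + τ * y)
    ring
  exact isNoetherianRing_of_isAdicComplete_span_singleton τ

/-- Over a noetherian ring, the completion of a flat module with respect to a principal ideal is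
flat over the completion of the ring. -/
theorem flat_span_singleton [IsNoetherianRing B] [Module.Flat B M] :
    Module.Flat (AdicCompletion (Ideal.span {t}) B) (AdicCompletion (Ideal.span {t}) M) := by
  have := isNoetherianRing_span_singleton t
  have := isAdicComplete_span_singleton_algebraMap t (M := M)
  refine .of_isAdicComplete_span_singleton (algebraMap B _ t) fun n l g z v hv ↦ ?_
  simp only [← map_pow, algebraMap_smul, ← Algebra.smul_def] at hv ⊢
  choose g' h hg using fun i ↦ exists_eq_of_add_pow_smul t n (g i)
  choose z' w hz using fun i ↦ exists_eq_of_add_pow_smul t n (z i)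
  obtain ⟨v', hv'⟩ : ∃ v', t ^ n • v' = ∑ i, g' i • z' i := by
    refine exists_pow_smul_eq_of_of_eq (y := v - ∑ i, (h i • z i + g' i • w i)) ?_
    rw [smul_sub, ← hv, map_sum, Finset.smul_sum, ← Finset.sum_sub_distrib]
    refine Finset.sum_congr rfl fun i _ ↦ ?_
    have hgz : g i • z i = g' i • z i + t ^ n • h i • z i := by
      nth_rw 1 [hg i]
      rw [add_smul, smul_assoc]
      congr 1
    rw [hgz, map_smul, smul_add, smul_comm (t ^ n) (g' i) (w i),
      show g' i • z i = g' i • of _ M (z' i) + g' i • t ^ n • w i by rw [hz i, smul_add]]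
    abel
  obtain ⟨k, a, y, ha, hga⟩ := Module.Flat.isTrivialRelation_of_sum_smul_eq_zero
    (f := fun i : Option (Fin l) ↦ i.elim (t ^ n) g') (x := fun i ↦ i.elim (-v') z')
    (by simp [Fintype.sum_option, hv'])
  refine ⟨k, fun i j ↦ algebraMap B _ (a (some i) j), fun j ↦ of _ M (y j), w,
    fun j ↦ ∑ i, a (some i) j • h i - algebraMap B _ (a none j), fun i ↦ ?_, fun j ↦ ?_⟩
  · have := ha (some i)
    simp only [Option.elim_some] at this
    simp [hz, this]
  · have hgaj : t ^ n * a none j + ∑ i, g' i * a (some i) j = 0 := by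
      simpa [Fintype.sum_option] using hga j
    have hsum (i : Fin l) : g i * algebraMap B _ (a (some i) j) =
        algebraMap B _ (g' i * a (some i) j) + t ^ n • a (some i) j • h i := by
      rw [hg i, add_mul, map_mul, smul_mul_assoc, Algebra.smul_def (a (some i) j), mul_comm (h i)]
      rfl
    simp_rw [hsum]
    rw [Finset.sum_add_distrib, ← map_sum, eq_neg_of_add_eq_zero_right hgaj, map_neg, map_mul,
      ← Algebra.smul_def, smul_sub, Finset.smul_sum]
    abel

end AdicCompletion

/-- Lemma 'lemma-flatness-completion': Let `B` be a Noetherian commutative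
ring, `t ∈ B`, and `A` a commutative `B`-algebra of finite type that is flat as a
`B`-module.  With `I = (t) ⊆ B`, the `I`-adic completion of `A` is flat as a module
over the `I`-adic completion of `B`. -/
theorem adicCompletion_flat
    {B : Type*} [CommRing B] [IsNoetherianRing B] (t : B)
    {A : Type*} [CommRing A] [Algebra B A] [Algebra.FiniteType B A]
    [Module.Flat B A] :
    Module.Flat (AdicCompletion (Ideal.span {t}) B)
      (AdicCompletion (Ideal.span {t}) A) := by
  exact AdicCompletion.flat_span_singleton t
end

section
/- Let B be a Noetherian commutative ring, t ∈ B, A a commutative B-algebra, and let B̂ denote the (t)-adic completion AdicCompletion (t) B of B, which is a B-algebra. Then for every integer l ≥ 1 there is an isomorphism of A-algebras (A ⊗_B B̂)/(t^l·(A ⊗_B B̂)) ≅ A/(t^l·A), compatible with the natural maps from A, where t^l·(A ⊗_B B̂) denotes the ideal generated by the image of t^l. -/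
open TensorProduct

namespace AdicCompletion

variable {R : Type*} [CommRing R] {I : Ideal R}

theorem ker_evalₐ_eq_map (h : I.FG) (n : ℕ) :
    RingHom.ker (evalₐ I n) = (I ^ n).map (algebraMap R (AdicCompletion I R)) := by
  have hI : (I ^ n • ⊤ : Ideal R) = I ^ n := by simp
  ext x
  have hx : x ∈ RingHom.ker (evalₐ I n) ↔ x ∈ (eval I R n).ker :=
    map_eq_zero_iff _ (Ideal.quotientEquivAlgOfEq R hI).injective
  rw [hx, ← pow_smul_top_eq_ker_eval h, Ideal.smul_top_eq_map, Submodule.restrictScalars_mem]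

/-- For a finitely generated ideal `I`, the quotient of the `I`-adic completion of `R` by the
extension of `I ^ n` is `R ⧸ I ^ n`. -/
noncomputable def quotientMapPowEquiv (h : I.FG) (n : ℕ) :
    (AdicCompletion I R ⧸ (I ^ n).map (algebraMap R (AdicCompletion I R))) ≃ₐ[R] R ⧸ I ^ n :=
  (Ideal.quotientEquivAlgOfEq R (ker_evalₐ_eq_map h n).symm).trans
    (Ideal.quotientKerAlgEquivOfSurjective (surjective_evalₐ I n))

/-- For a finitely generated ideal `I` of `R` and an `R`-algebra `A`, base change of `A` to the
`I`-adic completion of `R` does not change the quotient by the extension of `I ^ n`. -/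
noncomputable def tensorQuotientMapPowEquiv (A : Type*) [CommRing A] [Algebra R A]
    (h : I.FG) (n : ℕ) :
    ((A ⊗[R] AdicCompletion I R) ⧸
        (I ^ n).map (algebraMap R (A ⊗[R] AdicCompletion I R))) ≃ₐ[A]
      A ⧸ (I ^ n).map (algebraMap R A) :=
  have hmap : (I ^ n).map (algebraMap R (A ⊗[R] AdicCompletion I R)) =
      ((I ^ n).map (algebraMap R (AdicCompletion I R))).map
        (Algebra.TensorProduct.includeRight : AdicCompletion I R →ₐ[R] A ⊗[R] _) := by
    rw [← AlgHom.comp_algebraMap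
      (Algebra.TensorProduct.includeRight : AdicCompletion I R →ₐ[R] A ⊗[R] _), ← Ideal.map_map]
    rfl
  (Ideal.quotientEquivAlgOfEq A hmap).trans <|
    (Algebra.TensorProduct.tensorQuotientEquiv (R := R) A (AdicCompletion I R) A
      ((I ^ n).map (algebraMap R _))).symm.trans <|
    (Algebra.TensorProduct.congr AlgEquiv.refl (quotientMapPowEquiv h n)).trans
    (Algebra.TensorProduct.quotIdealMapEquivTensorQuot A (I ^ n)).symm

end AdicCompletion

theorem Ideal.map_span_singleton_pow {R S : Type*} [CommRing R] [CommRing S] (f : R →+* S)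
    (t : R) (n : ℕ) : (Ideal.span {t} ^ n).map f = Ideal.span {f t ^ n} := by
  rw [Ideal.map_pow, Ideal.map_span, Set.image_singleton, Ideal.span_singleton_pow]

/-- Let `B` be a Noetherian commutative ring, `t ∈ B`, `A` a commutative
`B`-algebra and `B̂ = AdicCompletion (t) B` the `(t)`-adic completion of `B`.  Then for
every `l ≥ 1` there is an isomorphism of `A`-algebras
`(A ⊗_B B̂)/(t^l·(A ⊗_B B̂)) ≅ A/(t^l·A)`. -/
theorem tensor_completion_mod_power_iso
    {B : Type*} [CommRing B] [IsNoetherianRing B] (t : B)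
    {A : Type*} [CommRing A] [Algebra B A] :
    ∀ l : ℕ, 1 ≤ l →
      Nonempty (
        ((A ⊗[B] AdicCompletion (Ideal.span {t}) B) ⧸
            Ideal.span {algebraMap B (A ⊗[B] AdicCompletion (Ideal.span {t}) B) t ^ l})
          ≃ₐ[A]
        (A ⧸ Ideal.span {algebraMap B A t ^ l})) := by
  intro l _
  exact ⟨(Ideal.quotientEquivAlgOfEq A (Ideal.map_span_singleton_pow _ t l).symm).trans <|
    (AdicCompletion.tensorQuotientMapPowEquiv A (IsNoetherian.noetherian _) l).trans
    (Ideal.quotientEquivAlgOfEq A (Ideal.map_span_singleton_pow _ t l))⟩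
end

section
/- In the setting of the previous statement (B Noetherian, t ∈ B a non-zerodivisor, P = B[z_1,…,z_n], A = P/(f_1,…,f_m) flat over B, A' a flat finite-type B-algebra, φ : A/t^kA ≅ A'/t^kA' a B-algebra isomorphism for some k ≥ 1, ẑ_i ∈ A' lifts of φ(z̄_i), I = (t)·P, and π̂ : AdicCompletion I P → AdicCompletion I A' the induced map of I-adic completions), let J denote the kernel of π̂, an ideal of AdicCompletion I P. Then J + (ι(t)^k) = (ι(f_1),…,ι(f_m)) + (ι(t)^k) as ideals of AdicCompletion I P, where ι : P → AdicCompletion I P is the canonical map and (·) denotes the generated ideal. -/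
namespace AdicCompletion

variable {R : Type*} [CommRing R] {N : Type*} [AddCommGroup N] [Module R N]

/-- An element of the `t`-adic completion of `R` agrees, up to a multiple of `t ^ k`, with any lift
to `R` of its image in `R / t ^ k`. -/
lemma exists_sub_algebraMap_mem_span_pow (t : R) (k : ℕ)
    (x : AdicCompletion (Ideal.span {t}) R) :
    ∃ p : R, x.val k = Submodule.Quotient.mk p ∧
      x - algebraMap R (AdicCompletion (Ideal.span {t}) R) p ∈
        Ideal.span {algebraMap R (AdicCompletion (Ideal.span {t}) R) t ^ k} := by
  obtain ⟨p, hp⟩ := Submodule.Quotient.mk_surjective _ (x.val k)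
  refine ⟨p, hp.symm, ?_⟩
  have hmem : x - algebraMap R (AdicCompletion (Ideal.span {t}) R) p ∈
      (eval (Ideal.span {t}) R k).ker := by
    rw [LinearMap.mem_ker, map_sub, sub_eq_zero, eval_apply, ← hp]
    rfl
  rw [← pow_smul_top_eq_ker_eval ⟨{t}, by simp⟩, Ideal.span_singleton_pow,
    Submodule.ideal_span_singleton_smul, Submodule.mem_smul_pointwise_iff_exists] at hmem
  obtain ⟨y, -, hy⟩ := hmem
  rw [← hy, Algebra.smul_def, map_pow]
  exact Ideal.mul_mem_right _ _ (Ideal.mem_span_singleton_self _)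

/-- If `g : R → N` is surjective modulo `t` and `K` is its kernel modulo `t ^ k`, then the kernel
of the `t`-adic completion of `g` agrees modulo `t ^ k` with the extension of `K`. -/
theorem ker_map_sup_span_pow (t : R) (k : ℕ) (g : R →ₗ[R] N) (K : Ideal R)
    (hsurj : Function.Surjective ((Ideal.span {t} • ⊤ : Submodule R N).mkQ ∘ₗ g))
    (hK : ∀ p, g p ∈ (Ideal.span {t} ^ k • ⊤ : Submodule R N) ↔ p ∈ K ⊔ Ideal.span {t ^ k}) :
    ((map (Ideal.span {t}) g).ker : Ideal (AdicCompletion (Ideal.span {t}) R)) ⊔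
        Ideal.span {algebraMap R (AdicCompletion (Ideal.span {t}) R) t ^ k} =
      K.map (algebraMap R (AdicCompletion (Ideal.span {t}) R)) ⊔
        Ideal.span {algebraMap R (AdicCompletion (Ideal.span {t}) R) t ^ k} := by
  apply le_antisymm
  · refine sup_le (fun x hx ↦ ?_) le_sup_right
    obtain ⟨p, hp, hxp⟩ := exists_sub_algebraMap_mem_span_pow t k x
    have hpK : p ∈ K ⊔ Ideal.span {t ^ k} := by
      rw [← hK, ← Submodule.Quotient.mk_eq_zero]
      have h : (map (Ideal.span {t}) g x).val k = 0 := by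
        rw [LinearMap.mem_ker.1 hx, val_zero_apply]
      rwa [map_val_apply, hp, LinearMap.reduceModIdeal_apply] at h
    rw [← sub_add_cancel x (algebraMap R _ p)]
    refine add_mem (Ideal.mem_sup_right hxp) ?_
    have h := Ideal.mem_map_of_mem (algebraMap R (AdicCompletion (Ideal.span {t}) R)) hpK
    rw [Ideal.map_sup, Ideal.map_span, Set.image_singleton, map_pow] at h
    exact h
  · refine sup_le (Ideal.map_le_iff_le_comap.2 fun p hp ↦ Ideal.mem_comap.2 ?_) le_sup_right
    have hgp := (hK p).2 (Ideal.mem_sup_left hp)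
    rw [Ideal.span_singleton_pow, Submodule.ideal_span_singleton_smul,
      Submodule.mem_smul_pointwise_iff_exists] at hgp
    obtain ⟨a, -, ha⟩ := hgp
    obtain ⟨y, hy⟩ := map_surjective_of_mkQ_comp_surjective hsurj (of (Ideal.span {t}) N a)
    rw [← sub_add_cancel (algebraMap R _ p) (t ^ k • y)]
    refine add_mem (Ideal.mem_sup_left ?_) (Ideal.mem_sup_right ?_)
    · have hof : map (Ideal.span {t}) g (algebraMap R _ p) = of (Ideal.span {t}) N (g p) :=
        map_of _ _ _
      have hsmul : map (Ideal.span {t}) g (t ^ k • y) =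
          t ^ k • map (Ideal.span {t}) g y := by
        rw [← algebraMap_smul (AdicCompletion (Ideal.span {t}) R), map_smul, algebraMap_smul]
      refine LinearMap.mem_ker.2 ?_
      rw [map_sub, hof, hsmul, hy, ← ha, map_smul, sub_self]
    · rw [Algebra.smul_def, map_pow]
      exact Ideal.mul_mem_right _ _ (Ideal.mem_span_singleton_self _)

end AdicCompletion

/-- key step (eq-eq-of-ideals) of 'Lifting equations': In the setting of
Statement 10, with `J = ker(π̂ : AdicCompletion I P → AdicCompletion I A')`, we have the
equality of ideals `J + (ι(t)^k) = (ι(f_1),…,ι(f_m)) + (ι(t)^k)` in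
`AdicCompletion I P`, where `ι : P → AdicCompletion I P` is the canonical map. -/
theorem lifting_equations_ideal_identity
    {B : Type*} [CommRing B] [IsNoetherianRing B] (t : B) (ht : t ∈ nonZeroDivisors B)
    (n m : ℕ) (f : Fin m → MvPolynomial (Fin n) B)
    (hA : Module.Flat B (MvPolynomial (Fin n) B ⧸ Ideal.span (Set.range f)))
    {A' : Type*} [CommRing A'] [Algebra B A'] [Algebra.FiniteType B A'] [Module.Flat B A']
    (k : ℕ) (hk : 1 ≤ k)
    (φ : ((MvPolynomial (Fin n) B ⧸ Ideal.span (Set.range f)) ⧸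
        Ideal.span {algebraMap B (MvPolynomial (Fin n) B ⧸ Ideal.span (Set.range f)) t ^ k})
        ≃ₐ[B] (A' ⧸ Ideal.span {algebraMap B A' t ^ k}))
    (zhat : Fin n → A')
    (hzhat : ∀ i : Fin n,
      Ideal.Quotient.mk (Ideal.span {algebraMap B A' t ^ k}) (zhat i) =
      φ (Ideal.Quotient.mk _
        (Ideal.Quotient.mk (Ideal.span (Set.range f)) (MvPolynomial.X i)))) :
    letI : Algebra (MvPolynomial (Fin n) B) A' :=
      (MvPolynomial.aeval zhat : MvPolynomial (Fin n) B →ₐ[B] A').toRingHom.toAlgebra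
    (LinearMap.ker (AdicCompletion.map
        (Ideal.span {(MvPolynomial.C t : MvPolynomial (Fin n) B)})
        (Algebra.linearMap (MvPolynomial (Fin n) B) A')) :
      Ideal (AdicCompletion (Ideal.span {(MvPolynomial.C t : MvPolynomial (Fin n) B)})
        (MvPolynomial (Fin n) B))) ⊔
      Ideal.span {algebraMap (MvPolynomial (Fin n) B)
        (AdicCompletion (Ideal.span {(MvPolynomial.C t : MvPolynomial (Fin n) B)})
          (MvPolynomial (Fin n) B)) (MvPolynomial.C t) ^ k} =
    Ideal.span (Set.range fun i : Fin m =>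
      algebraMap (MvPolynomial (Fin n) B)
        (AdicCompletion (Ideal.span {(MvPolynomial.C t : MvPolynomial (Fin n) B)})
          (MvPolynomial (Fin n) B)) (f i)) ⊔
      Ideal.span {algebraMap (MvPolynomial (Fin n) B)
        (AdicCompletion (Ideal.span {(MvPolynomial.C t : MvPolynomial (Fin n) B)})
          (MvPolynomial (Fin n) B)) (MvPolynomial.C t) ^ k} := by
  let : Algebra (MvPolynomial (Fin n) B) A' :=
    (MvPolynomial.aeval zhat : MvPolynomial (Fin n) B →ₐ[B] A').toRingHom.toAlgebra
  have hmap (p : MvPolynomial (Fin n) B) :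
      algebraMap (MvPolynomial (Fin n) B) A' p = MvPolynomial.aeval zhat p := rfl
  have hφ (p : MvPolynomial (Fin n) B) :
      Ideal.Quotient.mk (Ideal.span {algebraMap B A' t ^ k}) (MvPolynomial.aeval zhat p) =
        φ (Ideal.Quotient.mk _ (Ideal.Quotient.mk (Ideal.span (Set.range f)) p)) := by
    have h : (Ideal.Quotient.mkₐ B (Ideal.span {algebraMap B A' t ^ k})).comp
          (MvPolynomial.aeval zhat) =
        (φ.toAlgHom.comp (Ideal.Quotient.mkₐ B _)).comp
          (Ideal.Quotient.mkₐ B (Ideal.span (Set.range f))) :=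
      MvPolynomial.algHom_ext fun i ↦ by simpa using hzhat i
    exact DFunLike.congr_fun h p
  have hmem (j : ℕ) (a : A') :
      a ∈ (Ideal.span {(MvPolynomial.C t : MvPolynomial (Fin n) B)} ^ j • ⊤ :
        Submodule (MvPolynomial (Fin n) B) A') ↔ a ∈ Ideal.span {algebraMap B A' t ^ j} := by
    rw [Ideal.span_singleton_pow, Submodule.ideal_span_singleton_smul,
      Submodule.mem_smul_pointwise_iff_exists, Ideal.mem_span_singleton']
    simp [Algebra.smul_def, hmap, mul_comm]
  convert AdicCompletion.ker_map_sup_span_pow (MvPolynomial.C t) k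
    (Algebra.linearMap (MvPolynomial (Fin n) B) A') (Ideal.span (Set.range f)) ?_ ?_ using 2
  · rw [Ideal.map_span, ← Set.range_comp]
    rfl
  · intro q
    obtain ⟨a, rfl⟩ := Submodule.mkQ_surjective _ q
    obtain ⟨x, hx⟩ := φ.surjective (Ideal.Quotient.mk _ a)
    obtain ⟨x, rfl⟩ := Ideal.Quotient.mk_surjective x
    obtain ⟨p, rfl⟩ := Ideal.Quotient.mk_surjective x
    refine ⟨p, (Submodule.Quotient.eq _).2 ?_⟩
    rw [← hφ, Ideal.Quotient.eq, ← hmem] at hx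
    exact Submodule.smul_mono_left (Ideal.pow_le_self (by lia)) hx
  · intro p
    rw [hmem, Algebra.linearMap_apply, hmap, ← Ideal.Quotient.eq_zero_iff_mem, hφ,
      EmbeddingLike.map_eq_zero_iff, Ideal.Quotient.eq_zero_iff_mem, sup_comm,
      ← Ideal.mem_quotient_iff_mem_sup, Ideal.map_span, Set.image_singleton, map_pow]
    rfl
end

section
/- Let B be a commutative ring, t ∈ B, P = B[z_1,…,z_n] the polynomial ring over B, and f_1,…,f_m ∈ P such that the quotient A = P/(f_1,…,f_m) is flat as a B-module. Let l ≥ 1 and let a_1,…,a_m ∈ P satisfy a_1 f_1 + ⋯ + a_m f_m ∈ (t^l), the ideal of P generated by t^l. Then there exist a'_1,…,a'_m ∈ P such that (a_1 + t^l a'_1) f_1 + ⋯ + (a_m + t^l a'_m) f_m = 0. -/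
/-- In a flat module, an element killed by a scalar `s` is a linear combination with coefficients
in the annihilator of `s`. -/
theorem Module.Flat.exists_eq_sum_of_smul_eq_zero {R M : Type*} [CommRing R] [AddCommGroup M]
    [Module R M] [Module.Flat R M] {s : R} {x : M} (h : s • x = 0) :
    ∃ (k : ℕ) (c : Fin k → R) (y : Fin k → M), x = ∑ j, c j • y j ∧ ∀ j, s * c j = 0 := by
  have hx : ∑ i : Fin 1, (fun _ ↦ s : Fin 1 → R) i • (fun _ ↦ x : Fin 1 → M) i = 0 := by
    simpa using h
  obtain ⟨k, c, y, hy, hc⟩ := Module.Flat.isTrivialRelation_of_sum_smul_eq_zero hx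
  exact ⟨k, c 0, y, hy 0, fun j ↦ by simpa using hc j⟩

/-- If `P ⧸ I` is flat over `B` and `s • g ∈ I`, then `s • g` is already of the form `s • b` with
`b ∈ I`. -/
theorem Ideal.exists_mem_smul_eq_of_flat_quotient {B P : Type*} [CommRing B] [CommRing P]
    [Algebra B P] (I : Ideal P) [Module.Flat B (P ⧸ I)] {s : B} {g : P} (h : s • g ∈ I) :
    ∃ b ∈ I, s • b = s • g := by
  let q : P →ₗ[B] P ⧸ I := (Ideal.Quotient.mkₐ B I).toLinearMap
  have hq (p : P) : q p = 0 ↔ p ∈ I := Ideal.Quotient.eq_zero_iff_mem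
  have hg : s • q g = 0 := by
    rw [← map_smul, hq]
    exact h
  obtain ⟨k, c, y, hy, hc⟩ := Module.Flat.exists_eq_sum_of_smul_eq_zero (R := B) (M := P ⧸ I) hg
  have hqs : Function.Surjective q := Ideal.Quotient.mk_surjective
  choose z hz using fun j ↦ hqs (y j)
  refine ⟨g - ∑ j, c j • z j, ?_, ?_⟩
  · rw [← hq, map_sub, map_sum, sub_eq_zero]
    simpa only [map_smul, hz] using hy
  · simp [smul_sub, Finset.smul_sum, smul_smul, hc]

/-- Proposition 'Lifting relations': Let `B` be a commutative ring,
`t ∈ B`, `P = B[z_1,…,z_n]`, and `f_1,…,f_m ∈ P` with `A = P/(f_1,…,f_m)` flat over `B`.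
If `a_1 f_1 + ⋯ + a_m f_m ∈ (t^l)` for some `l ≥ 1`, then there are `a'_i ∈ P` with
`(a_1 + t^l a'_1) f_1 + ⋯ + (a_m + t^l a'_m) f_m = 0`. -/
theorem lifting_relations
    {B : Type*} [CommRing B] (t : B) (n m : ℕ)
    (f : Fin m → MvPolynomial (Fin n) B)
    (hA : Module.Flat B (MvPolynomial (Fin n) B ⧸ Ideal.span (Set.range f)))
    (l : ℕ) (hl : 1 ≤ l) (a : Fin m → MvPolynomial (Fin n) B)
    (h : (∑ i, a i * f i) ∈
      Ideal.span {(MvPolynomial.C t : MvPolynomial (Fin n) B) ^ l}) :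
    ∃ a' : Fin m → MvPolynomial (Fin n) B,
      (∑ i, (a i + (MvPolynomial.C t : MvPolynomial (Fin n) B) ^ l * a' i) * f i) = 0 := by
  obtain ⟨g, hg⟩ := Ideal.mem_span_singleton'.mp h
  have hsmul (p : MvPolynomial (Fin n) B) : t ^ l • p = MvPolynomial.C t ^ l * p := by
    rw [MvPolynomial.smul_eq_C_mul, map_pow]
  have hmem : t ^ l • g ∈ Ideal.span (Set.range f) := by
    rw [hsmul, mul_comm, hg]
    exact Ideal.sum_mem _ fun i _ ↦
      Ideal.mul_mem_left _ _ (Ideal.subset_span (Set.mem_range_self i))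
  obtain ⟨b, hb, hbg⟩ := Ideal.exists_mem_smul_eq_of_flat_quotient _ hmem
  obtain ⟨c, hc⟩ := Ideal.mem_span_range_iff_exists_fun.mp hb
  refine ⟨fun i ↦ -c i, ?_⟩
  rw [hsmul, hsmul, mul_comm _ g, hg, ← hc, Finset.mul_sum] at hbg
  simp only [add_mul, Finset.sum_add_distrib, ← hbg, mul_neg, neg_mul, mul_assoc,
    Finset.sum_neg_distrib, add_neg_cancel]
end
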